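/- Lower blow-up rate on convex domains (exponential case): Let Ω ⊂ ℝⁿ (n ≥ 2) be a bounded convex domain. Then there exists a constant N₁ > 0, depending only on n, λ, Λ, K and diam Ω, such that every u ∈ C²(Ω) satisfying Lu(x) = e^{u(x)} for all x ∈ Ω and u(x) → +∞ as d(x) → 0 obeys e^{u(x)} ≥ N₁ d(x)^{−2} for all x ∈ Ω. -/

import Mathlib

open Metric Set Filter Real Bornology

/-- First-order partial derivative `D_i u (x)`. -/
noncomputable def pd {n : ℕ} (u : EuclideanSpace ℝ (Fin n) → ℝ) (i : Fin n)
    (x : EuclideanSpace ℝ (Fin n)) : ℝ :=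
  fderiv ℝ u x (EuclideanSpace.single i 1)

/-- Second-order partial derivative `D_{ij} u (x)`. -/
noncomputable def pd2 {n : ℕ} (u : EuclideanSpace ℝ (Fin n) → ℝ) (i j : Fin n)
    (x : EuclideanSpace ℝ (Fin n)) : ℝ :=
  fderiv ℝ (fun y => fderiv ℝ u y (EuclideanSpace.single j 1)) x (EuclideanSpace.single i 1)

/-- The operator `L u = a^{ij} D_{ij} u + b^i D_i u - c u`. -/
noncomputable def Lop {n : ℕ} (a : EuclideanSpace ℝ (Fin n) → Fin n → Fin n → ℝ)
    (b : EuclideanSpace ℝ (Fin n) → Fin n → ℝ) (c : EuclideanSpace ℝ (Fin n) → ℝ)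
    (u : EuclideanSpace ℝ (Fin n) → ℝ) (x : EuclideanSpace ℝ (Fin n)) : ℝ :=
  (∑ i, ∑ j, a x i j * pd2 u i j x) + (∑ i, b x i * pd u i x) - c x * u x

/-- The standing assumptions on the coefficients of `L`: measurability, symmetry,
`Σ (b^i)² ≤ K`, `0 ≤ c ≤ K`, `K > 0`, and uniform ellipticity `λ|ξ|² ≤ aᵢⱼξᵢξⱼ ≤ Λ|ξ|²`
with `0 < λ ≤ Λ`. -/
def CoeffsOK {n : ℕ} (a : EuclideanSpace ℝ (Fin n) → Fin n → Fin n → ℝ)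
    (b : EuclideanSpace ℝ (Fin n) → Fin n → ℝ) (c : EuclideanSpace ℝ (Fin n) → ℝ)
    (K lam Lam : ℝ) : Prop :=
  (∀ i j, Measurable fun x => a x i j) ∧ (∀ i, Measurable fun x => b x i) ∧
  Measurable c ∧ (∀ x i j, a x i j = a x j i) ∧
  (∀ x, ∑ i, (b x i) ^ 2 ≤ K) ∧ (∀ x, 0 ≤ c x ∧ c x ≤ K) ∧
  0 < K ∧ 0 < lam ∧ lam ≤ Lam ∧
  (∀ x (ξ : EuclideanSpace ℝ (Fin n)),
    lam * ‖ξ‖ ^ 2 ≤ ∑ i, ∑ j, a x i j * ξ i * ξ j ∧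
    ∑ i, ∑ j, a x i j * ξ i * ξ j ≤ Lam * ‖ξ‖ ^ 2)

/-- `u(x) → +∞` as `d(x) := dist(x, ∂Ω) → 0`. -/
def BlowsUp {n : ℕ} (Ω : Set (EuclideanSpace ℝ (Fin n)))
    (u : EuclideanSpace ℝ (Fin n) → ℝ) : Prop :=
  ∀ M : ℝ, ∃ δ > 0, ∀ x ∈ Ω, infDist x (frontier Ω) < δ → M ≤ u x

lemma one_dim_test {h : ℝ → ℝ} (hc : ContinuousAt h 0) (hm : IsLocalMin h 0) :
    0 ≤ deriv (deriv h) 0 := by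
  by_contra! hneg
  have h0 : deriv h 0 = 0 := hm.deriv_eq_zero
  have hmax : IsLocalMax h 0 := isLocalMax_of_deriv_deriv_neg hneg h0 hc
  have heq : h =ᶠ[nhds 0] fun _ => h 0 := by
    filter_upwards [hm, hmax] with t h1 h2
    exact le_antisymm h2 h1
  have := heq.deriv.deriv_eq
  simp at this
  linarith

lemma hess_nonneg {E : Type*} [NormedAddCommGroup E] [NormedSpace ℝ E] {v : E → ℝ} {x : E}
    (hv : ContDiffAt ℝ 2 v x) (hm : IsLocalMin v x) (ξ : E) :
    0 ≤ fderiv ℝ (fderiv ℝ v) x ξ ξ := by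
  have hγ : ∀ t : ℝ, HasDerivAt (fun t : ℝ => x + t • ξ) ξ t := fun t => by
    simpa using ((hasDerivAt_id t).smul_const ξ).const_add x
  have hγ0 : Tendsto (fun t : ℝ => x + t • ξ) (nhds 0) (nhds x) := by
    have := (hγ 0).continuousAt.tendsto
    simpa using this
  have hev : ∀ᶠ y in nhds x, ContDiffAt ℝ 2 v y := hv.eventually (by simp)
  have hd : deriv (fun t : ℝ => v (x + t • ξ)) =ᶠ[nhds 0] fun t => fderiv ℝ v (x + t • ξ) ξ := by
    filter_upwards [hγ0.eventually hev] with t ht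
    exact ((ht.differentiableAt (by norm_num)).hasFDerivAt.comp_hasDerivAt t (hγ t)).deriv
  have hF : DifferentiableAt ℝ (fderiv ℝ v) x :=
    (hv.fderiv_right (m := 1) (by norm_num)).differentiableAt (by norm_num)
  have hF' : HasFDerivAt (fderiv ℝ v) (fderiv ℝ (fderiv ℝ v) x) (x + (0:ℝ) • ξ) := by
    simpa using hF.hasFDerivAt
  have h2 : HasDerivAt (fun t : ℝ => fderiv ℝ v (x + t • ξ) ξ) (fderiv ℝ (fderiv ℝ v) x ξ ξ) 0 := by
    have hG : HasFDerivAt (fun y => fderiv ℝ v y ξ) ((fderiv ℝ (fderiv ℝ v) x).flip ξ)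
        (x + (0:ℝ) • ξ) := by
      simpa using hF'.clm_apply (hasFDerivAt_const ξ _)
    exact hG.comp_hasDerivAt (0:ℝ) (hγ 0)
  have h3 := one_dim_test (h := fun t : ℝ => v (x + t • ξ))
    (by
      have : ContinuousAt v (x + (0:ℝ) • ξ) := by simpa using hv.continuousAt
      exact ContinuousAt.comp (f := fun t : ℝ => x + t • ξ) this (hγ 0).continuousAt)
    (by
      have := hγ0.eventually hm
      unfold IsLocalMin IsMinFilter
      simpa using this)
  rwa [hd.deriv_eq, h2.deriv] at h3

open scoped MatrixOrder in
lemma posSemidef_factor {n : ℕ} {A : Matrix (Fin n) (Fin n) ℝ} (hA : A.PosSemidef) :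
    ∃ B : Matrix (Fin n) (Fin n) ℝ, A = star B * B :=
  CStarAlgebra.nonneg_iff_eq_star_mul_self.mp hA.nonneg

lemma trace_nonneg {n : ℕ} (A : Fin n → Fin n → ℝ) (hs : ∀ i j, A i j = A j i)
    (hA : ∀ ξ : EuclideanSpace ℝ (Fin n), 0 ≤ ∑ i, ∑ j, A i j * ξ i * ξ j)
    (Q : EuclideanSpace ℝ (Fin n) →L[ℝ] EuclideanSpace ℝ (Fin n) →L[ℝ] ℝ)
    (hQ : ∀ ξ, 0 ≤ Q ξ ξ) :
    0 ≤ ∑ i, ∑ j, A i j * Q (EuclideanSpace.single i 1) (EuclideanSpace.single j 1) := by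
  have hP : (Matrix.of A).PosSemidef := by
    refine Matrix.PosSemidef.of_dotProduct_mulVec_nonneg ?_ ?_
    · ext i j; simp [hs i j]
    · intro x
      have := hA (WithLp.toLp 2 x)
      simp only [dotProduct, Matrix.mulVec, Finset.mul_sum]
      refine this.trans_eq (Finset.sum_congr rfl fun i _ => Finset.sum_congr rfl fun j _ => ?_)
      simp only [Matrix.of_apply, Pi.star_apply, star_trivial]; ring
  obtain ⟨B, hB⟩ := posSemidef_factor hP
  have hAB : ∀ i j, A i j = ∑ k, B k i * B k j := by
    intro i j
    have := congrFun (congrFun hB i) j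
    simpa [Matrix.mul_apply, Matrix.star_apply] using this
  have key : ∀ k, Q (∑ i, B k i • EuclideanSpace.single i (1:ℝ)) (∑ i, B k i • EuclideanSpace.single i (1:ℝ))
      = ∑ i, ∑ j, B k i * B k j * Q (EuclideanSpace.single i 1) (EuclideanSpace.single j 1) := by
    intro k
    simp only [map_sum, map_smul, sum_apply, smul_apply, smul_eq_mul, Finset.mul_sum]
    try rw [Finset.sum_comm]
    refine Finset.sum_congr rfl fun i _ => Finset.sum_congr rfl fun j _ => by ring
  have : ∑ i, ∑ j, A i j * Q (EuclideanSpace.single i 1) (EuclideanSpace.single j 1)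
      = ∑ k, Q (∑ i, B k i • EuclideanSpace.single i (1:ℝ)) (∑ i, B k i • EuclideanSpace.single i (1:ℝ)) := by
    simp only [key, hAB, Finset.sum_mul]
    rw [Finset.sum_comm (γ := Fin n)]
    rw [Finset.sum_comm]
    symm
    rw [Finset.sum_comm]
    exact Finset.sum_congr rfl fun i _ => Finset.sum_comm
  rw [this]
  exact Finset.sum_nonneg fun k _ => hQ _

lemma pd2_eq {n : ℕ} {u : EuclideanSpace ℝ (Fin n) → ℝ} {x : EuclideanSpace ℝ (Fin n)}
    (hu : ContDiffAt ℝ 2 u x) (i j : Fin n) :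
    pd2 u i j x = fderiv ℝ (fderiv ℝ u) x (EuclideanSpace.single i 1) (EuclideanSpace.single j 1) := by
  have hF : DifferentiableAt ℝ (fderiv ℝ u) x :=
    (hu.fderiv_right (m := 1) (by norm_num)).differentiableAt (by norm_num)
  have := (hF.hasFDerivAt.clm_apply (hasFDerivAt_const (EuclideanSpace.single j (1:ℝ)) x)).fderiv
  unfold pd2
  rw [this]
  simp

lemma Lop_compare {n : ℕ} {a : EuclideanSpace ℝ (Fin n) → Fin n → Fin n → ℝ}
    {b : EuclideanSpace ℝ (Fin n) → Fin n → ℝ} {c : EuclideanSpace ℝ (Fin n) → ℝ}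
    {K lam Lam : ℝ} (hC : CoeffsOK a b c K lam Lam)
    {u w : EuclideanSpace ℝ (Fin n) → ℝ} {x : EuclideanSpace ℝ (Fin n)}
    (hu : ContDiffAt ℝ 2 u x) (hw : ContDiffAt ℝ 2 w x)
    (hm : IsLocalMin (fun y => u y - w y) x) (hlt : u x ≤ w x) :
    Lop a b c w x ≤ Lop a b c u x := by
  obtain ⟨_, _, _, hs, hb, hc, hK, hl, hlL, hell⟩ := hC
  have hev : ∀ᶠ y in nhds x, ContDiffAt ℝ 2 u y := hu.eventually (by simp)
  have hev' : ∀ᶠ y in nhds x, ContDiffAt ℝ 2 w y := hw.eventually (by simp)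
  have hF : DifferentiableAt ℝ (fderiv ℝ u) x :=
    (hu.fderiv_right (m := 1) (by norm_num)).differentiableAt (by norm_num)
  have hG : DifferentiableAt ℝ (fderiv ℝ w) x :=
    (hw.fderiv_right (m := 1) (by norm_num)).differentiableAt (by norm_num)
  have hd : fderiv ℝ (fun y => u y - w y) =ᶠ[nhds x] fun y => fderiv ℝ u y - fderiv ℝ w y := by
    filter_upwards [hev, hev'] with y h1 h2
    exact fderiv_fun_sub (h1.differentiableAt (by norm_num)) (h2.differentiableAt (by norm_num))
  have hd2 : fderiv ℝ (fderiv ℝ (fun y => u y - w y)) x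
      = fderiv ℝ (fderiv ℝ u) x - fderiv ℝ (fderiv ℝ w) x := by
    rw [hd.fderiv_eq, fderiv_fun_sub hF hG]
  have hgrad : fderiv ℝ u x = fderiv ℝ w x := by
    have := hm.fderiv_eq_zero
    rw [hd.eq_of_nhds] at this
    exact sub_eq_zero.mp this
  have hH := trace_nonneg (a x) (hs x)
    (fun ξ => le_trans (by positivity) (hell x ξ).1)
    (fderiv ℝ (fderiv ℝ (fun y => u y - w y)) x) (hess_nonneg (hu.sub hw) hm)
  rw [hd2] at hH
  simp only [sub_apply, mul_sub, Finset.sum_sub_distrib] at hH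
  unfold Lop
  simp only [pd2_eq hu, pd2_eq hw, pd, hgrad]
  have := mul_le_mul_of_nonneg_left hlt (hc x).1
  linarith

lemma Lop_radial {n : ℕ} {a : EuclideanSpace ℝ (Fin n) → Fin n → Fin n → ℝ}
    {b : EuclideanSpace ℝ (Fin n) → Fin n → ℝ} {c : EuclideanSpace ℝ (Fin n) → ℝ}
    (φ φ' : ℝ → ℝ) (p : ℝ) (e : EuclideanSpace ℝ (Fin n)) (k : ℝ) (x : EuclideanSpace ℝ (Fin n))
    (h1 : ∀ᶠ s in nhds (inner ℝ e x - k), HasDerivAt φ (φ' s) s)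
    (h2 : HasDerivAt φ' p (inner ℝ e x - k)) :
    Lop a b c (fun y => φ (inner ℝ e y - k)) x =
      p * (∑ i, ∑ j, a x i j * e i * e j) + φ' (inner ℝ e x - k) * (∑ i, b x i * e i)
        - c x * φ (inner ℝ e x - k) := by
  have hℓ : ∀ y, HasFDerivAt (fun y => inner ℝ e y - k) (innerSL ℝ e) y := fun y => by
    simpa using (innerSL ℝ e).hasFDerivAt.sub_const k
  have hev : ∀ᶠ y in nhds x, HasDerivAt φ (φ' (inner ℝ e y - k)) (inner ℝ e y - k) :=
    (hℓ x).continuousAt.tendsto.eventually h1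
  have hd : ∀ᶠ y in nhds x, fderiv ℝ (fun y => φ (inner ℝ e y - k)) y
      = φ' (inner ℝ e y - k) • innerSL ℝ e := by
    filter_upwards [hev] with y hy
    exact (hy.comp_hasFDerivAt y (hℓ y)).fderiv
  have hin : ∀ i, inner ℝ e (EuclideanSpace.single i (1:ℝ)) = e i := fun i => by
    rw [EuclideanSpace.inner_single_right]; simp
  have hp1 : ∀ i, pd (fun y => φ (inner ℝ e y - k)) i x = φ' (inner ℝ e x - k) * e i := by
    intro i
    unfold pd
    rw [hd.self_of_nhds]
    simp [hin]
  have hp2 : ∀ i j, pd2 (fun y => φ (inner ℝ e y - k)) i j x = p * e i * e j := by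
    intro i j
    unfold pd2
    have : (fun y => fderiv ℝ (fun y => φ (inner ℝ e y - k)) y (EuclideanSpace.single j 1))
        =ᶠ[nhds x] fun y => φ' (inner ℝ e y - k) * e j := by
      filter_upwards [hd] with y hy
      rw [hy]; simp [hin]
    have h3 : HasFDerivAt (fun y => φ' (inner ℝ e y - k) * e j) (e j • (p • innerSL ℝ e)) x :=
      (h2.comp_hasFDerivAt x (hℓ x)).mul_const (e j)
    rw [this.fderiv_eq, h3.fderiv]
    simp [hin]; ring
  unfold Lop
  simp only [hp1, hp2, Finset.mul_sum]
  congr 2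
  · exact Finset.sum_congr rfl fun i _ => Finset.sum_congr rfl fun j _ => by ring
  · exact Finset.sum_congr rfl fun i _ => by ring

lemma phi_deriv (A μ s : ℝ) (hμ : 0 < μ) (hs : 0 < s) :
    HasDerivAt (fun s => Real.log A - 2 * Real.log (1 - Real.exp (-μ * s)))
      (-2 * μ * Real.exp (-μ * s) / (1 - Real.exp (-μ * s))) s := by
  have hq : Real.exp (-μ * s) < 1 := by
    rw [Real.exp_lt_one_iff]; nlinarith
  have h1 : HasDerivAt (fun s => 1 - Real.exp (-μ * s)) (-(Real.exp (-μ * s) * (-μ))) s := by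
    have := (((hasDerivAt_id s).const_mul (-μ)).exp).const_sub 1
    simpa using this
  have h2 := ((h1.log (by linarith)).const_mul 2).const_sub (Real.log A)
  refine h2.congr_deriv ?_
  ring

lemma phi_deriv2 (μ s : ℝ) (hμ : 0 < μ) (hs : 0 < s) :
    HasDerivAt (fun s => -2 * μ * Real.exp (-μ * s) / (1 - Real.exp (-μ * s)))
      (2 * μ ^ 2 * Real.exp (-μ * s) / (1 - Real.exp (-μ * s)) ^ 2) s := by
  have hq : Real.exp (-μ * s) < 1 := by
    rw [Real.exp_lt_one_iff]; nlinarith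
  have h0 : HasDerivAt (fun s => Real.exp (-μ * s)) (Real.exp (-μ * s) * (-μ)) s := by
    have := ((hasDerivAt_id s).const_mul (-μ)).exp
    simpa using this
  have h2 := (h0.const_mul (-2 * μ)).div (h0.const_sub 1) (by linarith)
  refine h2.congr_deriv ?_
  congr 1
  ring

lemma barrier_ineq {K lam μ q A T S B C : ℝ} (hlam : 0 < lam) (hμ : 0 < μ)
    (hKμ : lam * μ = Real.sqrt K) (hq0 : 0 < q) (hq1 : q < 1) (hA : 0 < A)
    (hAq : A * (1 + K) ≤ 2 * lam * μ ^ 2 * q ^ 2)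
    (hS : lam ≤ S) (hB : B ≤ Real.sqrt K) (hC0 : 0 ≤ C) (hCK : C ≤ K)
    (hT : T = Real.log A - 2 * Real.log (1 - q)) :
    Real.exp T ≤ 2 * μ ^ 2 * q / (1 - q) ^ 2 * S + -2 * μ * q / (1 - q) * B - C * T := by
  have hg : 0 < 1 - q := by linarith
  have hexp : Real.exp T = A / (1 - q) ^ 2 := by
    rw [hT, Real.exp_sub, Real.exp_log hA, two_mul, Real.exp_add, Real.exp_log hg, sq]
  have hCT : C * T ≤ K * (A / (1 - q) ^ 2) := by
    have h1 : T ≤ Real.exp T := by linarith [Real.add_one_le_exp T]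
    rw [← hexp]
    have := Real.exp_pos T
    nlinarith
  have h1 : 2 * μ ^ 2 * q / (1 - q) ^ 2 * lam ≤ 2 * μ ^ 2 * q / (1 - q) ^ 2 * S :=
    mul_le_mul_of_nonneg_left hS (by positivity)
  have h2 : 2 * μ * q / (1 - q) * B ≤ 2 * μ * q / (1 - q) * (lam * μ) := by
    rw [hKμ]
    exact mul_le_mul_of_nonneg_left hB (by positivity)
  have h3 : -2 * μ * q / (1 - q) * B = -(2 * μ * q / (1 - q) * B) := by ring
  have h4 : 2 * μ ^ 2 * q / (1 - q) ^ 2 * lam - 2 * μ * q / (1 - q) * (lam * μ)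
      = 2 * lam * μ ^ 2 * q ^ 2 / (1 - q) ^ 2 := by
    field_simp
    ring
  have h5 : A * (1 + K) / (1 - q) ^ 2 ≤ 2 * lam * μ ^ 2 * q ^ 2 / (1 - q) ^ 2 := by
    gcongr
  have h6 : A * (1 + K) / (1 - q) ^ 2 = A / (1 - q) ^ 2 + K * (A / (1 - q) ^ 2) := by ring
  rw [hexp, h3]
  linarith

lemma exists_support {n : ℕ} {Ω : Set (EuclideanSpace ℝ (Fin n))} (ho : IsOpen Ω)
    (hne : Ω.Nonempty) (hc : Convex ℝ Ω) {y : EuclideanSpace ℝ (Fin n)} (hy : y ∉ Ω) :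
    ∃ e : EuclideanSpace ℝ (Fin n), ‖e‖ = 1 ∧ ∀ x ∈ Ω, 0 < inner ℝ e (x - y) := by
  obtain ⟨f, hf⟩ := geometric_hahn_banach_open_point hc ho hy
  obtain ⟨z, hz⟩ := hne
  set v := (InnerProductSpace.toDual ℝ (EuclideanSpace ℝ (Fin n))).symm f with hv
  have hvf : ∀ x, inner ℝ v x = f x := fun x => InnerProductSpace.toDual_symm_apply
  have hv0 : v ≠ 0 := by
    intro h
    have h1 := hf z hz
    rw [← hvf, ← hvf, h] at h1
    simp at h1
  have hn : 0 < ‖v‖ := norm_pos_iff.mpr hv0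
  refine ⟨-(‖v‖⁻¹ • v), ?_, ?_⟩
  · rw [norm_neg, norm_smul, norm_inv, norm_norm, inv_mul_cancel₀ hn.ne']
  · intro x hx
    rw [inner_neg_left, real_inner_smul_left, hvf, map_sub]
    have := hf x hx
    have : 0 < ‖v‖⁻¹ * (f y - f x) := mul_pos (inv_pos.mpr hn) (by linarith)
    linarith

lemma cs_bound {n : ℕ} (b : Fin n → ℝ) (e : EuclideanSpace ℝ (Fin n)) (K : ℝ)
    (hb : ∑ i, b i ^ 2 ≤ K) (he : ‖e‖ = 1) : ∑ i, b i * e i ≤ Real.sqrt K := by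
  apply Real.le_sqrt_of_sq_le
  have h1 := Finset.sum_mul_sq_le_sq_mul_sq Finset.univ b (fun i => e i)
  have h2 : ∑ i, e i ^ 2 = 1 := by
    have := EuclideanSpace.real_norm_sq_eq e
    rw [he] at this
    linarith
  rw [h2] at h1
  linarith

/-- Comparison principle with a bounded `C²` barrier. -/
lemma comparison {n : ℕ} {Ω : Set (EuclideanSpace ℝ (Fin n))} (ho : IsOpen Ω)
    (hbd : IsBounded Ω) {u w : EuclideanSpace ℝ (Fin n) → ℝ} (hu : ContinuousOn u Ω)
    (hw : ContinuousOn w Ω) {M : ℝ} (hM : ∀ x ∈ Ω, w x ≤ M) (hB : BlowsUp Ω u)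
    (hloc : ∀ x ∈ Ω, IsLocalMin (fun y => u y - w y) x → ¬ u x < w x) :
    ∀ x ∈ Ω, w x ≤ u x := by
  intro x hx
  by_contra! hlt
  obtain ⟨δ, hδ, hδu⟩ := hB M
  set S := closure Ω ∩ {y | δ ≤ infDist y (frontier Ω)} with hS
  have hSc : IsCompact S :=
    hbd.isCompact_closure.inter_right
      (isClosed_le continuous_const (continuous_infDist_pt _))
  have hSΩ : S ⊆ Ω := by
    rintro y ⟨hy1, hy2⟩
    by_contra hy
    have : y ∈ frontier Ω := by
      rw [frontier, ho.interior_eq]; exact ⟨hy1, hy⟩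
    have h0 := infDist_zero_of_mem this
    simp only [mem_ofPred_eq, h0] at hy2
    linarith
  have hout : ∀ y ∈ Ω, y ∉ S → 0 ≤ u y - w y := by
    intro y hy hyS
    have : infDist y (frontier Ω) < δ := by
      by_contra! h
      exact hyS ⟨subset_closure hy, h⟩
    linarith [hδu y hy this, hM y hy]
  have hxS : x ∈ S := by
    by_contra h
    linarith [hout x hx h]
  obtain ⟨z, hzS, hz⟩ := hSc.exists_isMinOn ⟨x, hxS⟩ ((hu.sub hw).mono hSΩ)
  have hzx : u z - w z ≤ u x - w x := hz hxS
  refine hloc z (hSΩ hzS) ?_ (by linarith)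
  filter_upwards [ho.mem_nhds (hSΩ hzS)] with y hy
  by_cases hyS : y ∈ S
  · exact hz hyS
  · linarith [hout y hy hyS]

/-- lower blow-up rate from the proof of Theorem 3.2. If `Ω` is a
bounded convex domain, then there is `N₁ > 0` depending only on `n, λ, Λ, K` and
`diam Ω` (formalized as a positive function of the diameter) such that every
blow-up solution of `Lu = e^u` satisfies `e^u ≥ N₁ d^{-2}` in `Ω`. -/
theorem lower_rate_exponential_convex {n : ℕ} (hn : 2 ≤ n)
    (K lam Lam : ℝ) (hK : 0 < K) (hlam : 0 < lam) (hlL : lam ≤ Lam) :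
    ∃ N₁ : ℝ → ℝ, (∀ D : ℝ, 0 < N₁ D) ∧
      ∀ (Ω : Set (EuclideanSpace ℝ (Fin n))),
        IsOpen Ω → IsConnected Ω → IsBounded Ω → Convex ℝ Ω →
      ∀ (a : EuclideanSpace ℝ (Fin n) → Fin n → Fin n → ℝ)
        (b : EuclideanSpace ℝ (Fin n) → Fin n → ℝ)
        (c : EuclideanSpace ℝ (Fin n) → ℝ), CoeffsOK a b c K lam Lam →
      ∀ u : EuclideanSpace ℝ (Fin n) → ℝ, ContDiffOn ℝ 2 u Ω →
        (∀ x ∈ Ω, Lop a b c u x = Real.exp (u x)) → BlowsUp Ω u →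
        ∀ x ∈ Ω, N₁ (diam Ω) / infDist x (frontier Ω) ^ 2 ≤ Real.exp (u x) := by
  have hsK : 0 < Real.sqrt K := Real.sqrt_pos.mpr hK
  set μ : ℝ := Real.sqrt K / lam with hμdef
  have hμ : 0 < μ := div_pos hsK hlam
  have hKμ : lam * μ = Real.sqrt K := by rw [hμdef]; field_simp
  refine ⟨fun D => lam * Real.exp (-μ * (D + 1)) ^ 2 / (2 * (1 + K)), fun D => by positivity, ?_⟩
  intro Ω ho hconn hbd hconv a b c hC u hu hLu hB x₀ hx₀
  set d := infDist x₀ (frontier Ω) with hd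
  have hdnn : 0 ≤ d := infDist_nonneg
  rcases hdnn.eq_or_lt with hd0 | hdpos
  · rw [← hd0]; simp; positivity
  have hfne : (frontier Ω).Nonempty := by
    by_contra h
    rw [not_nonempty_iff_eq_empty] at h
    rw [hd, h, infDist_empty] at hdpos
    exact lt_irrefl _ hdpos
  obtain ⟨y₀, hy₀, hdy⟩ := (isClosed_frontier (s := Ω)).exists_infDist_eq_dist hfne x₀
  have hy₀Ω : y₀ ∉ Ω := by
    rw [frontier, ho.interior_eq] at hy₀; exact hy₀.2
  obtain ⟨e, he, hepos⟩ := exists_support ho ⟨x₀, hx₀⟩ hconv hy₀Ω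
  set D := diam Ω with hD
  have hle : ∀ x, inner ℝ e (x - y₀) ≤ dist x y₀ := by
    intro x
    have := real_inner_le_norm e (x - y₀)
    rwa [he, one_mul, ← dist_eq_norm] at this
  have hleD : ∀ x ∈ Ω, inner ℝ e (x - y₀) ≤ D := by
    intro x hx
    refine (hle x).trans ?_
    rw [hD, ← Metric.diam_closure]
    exact dist_le_diam_of_mem hbd.closure (subset_closure hx) (frontier_subset_closure hy₀)
  set ε : ℝ := min d 1 with hε
  have hεpos : 0 < ε := lt_min hdpos one_pos
  set k : ℝ := inner ℝ e y₀ - ε with hk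
  have hs : ∀ x, inner ℝ e x - k = inner ℝ e (x - y₀) + ε := by
    intro x; rw [inner_sub_right, hk]; ring
  set A : ℝ := 2 * lam * μ ^ 2 * Real.exp (-μ * (D + 1)) ^ 2 / (1 + K) with hA
  have hApos : 0 < A := by positivity
  set φ : ℝ → ℝ := fun s => Real.log A - 2 * Real.log (1 - Real.exp (-μ * s)) with hφ
  have hspos : ∀ x ∈ Ω, ε < inner ℝ e x - k := fun x hx => by
    rw [hs]; linarith [hepos x hx]
  have hq1 : ∀ s : ℝ, 0 < s → Real.exp (-μ * s) < 1 := fun s h => by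
    rw [Real.exp_lt_one_iff]; nlinarith
  have hwC : ∀ x ∈ Ω, ContDiffAt ℝ 2 (fun y => φ (inner ℝ e y - k)) x := by
    intro x hx
    have h1 : 1 - Real.exp (-μ * (inner ℝ e x - k)) ≠ 0 := by
      linarith [hq1 _ (hεpos.trans (hspos x hx))]
    have h2 : ContDiffAt ℝ 2 (fun y => 1 - Real.exp (-μ * (inner ℝ e y - k))) x := by
      have h3 : ContDiffAt ℝ 2 (fun y => inner ℝ e y) x := contDiffAt_const.inner ℝ contDiffAt_id
      fun_prop
    exact contDiffAt_const.sub (contDiffAt_const.mul (h2.log h1))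
  have huC : ∀ x ∈ Ω, ContDiffAt ℝ 2 u x := fun x hx => hu.contDiffAt (ho.mem_nhds hx)
  have key : ∀ x ∈ Ω, φ (inner ℝ e x - k) ≤ u x := by
    refine comparison (M := φ ε) ho hbd hu.continuousOn
      (fun x hx => (hwC x hx).continuousAt.continuousWithinAt) ?_ hB ?_
    · intro x hx
      have h1 := hspos x hx
      have h2 : Real.exp (-μ * (inner ℝ e x - k)) ≤ Real.exp (-μ * ε) :=
        Real.exp_le_exp.mpr (by nlinarith)
      have h3 := Real.log_le_log (x := 1 - Real.exp (-μ * ε)) (by linarith [hq1 ε hεpos])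
        (show _ ≤ 1 - Real.exp (-μ * (inner ℝ e x - k)) by linarith)
      simp only [hφ]
      linarith
    · intro x hx hm hlt
      have hcmp := Lop_compare hC (huC x hx) (hwC x hx) hm hlt.le
      obtain ⟨_, _, _, hsy, hb, hc, _, _, _, hell⟩ := hC
      have hs0 := hεpos.trans (hspos x hx)
      rw [hLu x hx, Lop_radial φ
        (fun s => -2 * μ * Real.exp (-μ * s) / (1 - Real.exp (-μ * s))) _ e k x
        (by
          filter_upwards [lt_mem_nhds hs0] with s hs
          exact phi_deriv A μ s hμ hs)
        (phi_deriv2 μ _ hμ hs0)] at hcmp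
      have hq : Real.exp (-μ * (D + 1)) ≤ Real.exp (-μ * (inner ℝ e x - k)) := by
        apply Real.exp_le_exp.mpr
        have h1 := hleD x hx
        have h2 : ε ≤ 1 := min_le_right _ _
        have h3 := hs x
        nlinarith
      have hbar := barrier_ineq (K := K) (T := φ (inner ℝ e x - k)) hlam hμ hKμ (Real.exp_pos _) (hq1 _ hs0) hApos
        (by
          have : A * (1 + K) = 2 * lam * μ ^ 2 * Real.exp (-μ * (D + 1)) ^ 2 := by
            rw [hA]; field_simp
          rw [this]
          gcongr)
        (by simpa [he] using (hell x e).1) (cs_bound (b x) e K (hb x) he) (hc x).1 (hc x).2 rfl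
      have := Real.exp_lt_exp.mpr hlt
      linarith
  have hs0 := hεpos.trans (hspos x₀ hx₀)
  have hfin := Real.exp_le_exp.mpr (key x₀ hx₀)
  refine le_trans ?_ hfin
  have hg : 0 < 1 - Real.exp (-μ * (inner ℝ e x₀ - k)) := by linarith [hq1 _ hs0]
  have hexp : Real.exp (φ (inner ℝ e x₀ - k)) = A / (1 - Real.exp (-μ * (inner ℝ e x₀ - k))) ^ 2 := by
    simp only [hφ]
    rw [Real.exp_sub, Real.exp_log hApos, two_mul, Real.exp_add, Real.exp_log hg, sq]
  rw [hexp]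
  have hgle : 1 - Real.exp (-μ * (inner ℝ e x₀ - k)) ≤ μ * (2 * d) := by
    have h1 := Real.add_one_le_exp (-μ * (inner ℝ e x₀ - k))
    have h2 : inner ℝ e x₀ - k ≤ 2 * d := by
      rw [hs]
      have := hle x₀
      rw [← hdy] at this
      have h2 : ε ≤ d := min_le_left _ _
      linarith
    nlinarith
  calc lam * Real.exp (-μ * (D + 1)) ^ 2 / (2 * (1 + K)) / d ^ 2 = A / (μ * (2 * d)) ^ 2 := by
        rw [hA]; field_simp
    _ ≤ _ := by gcongr
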